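/- If S is a finite nonempty sequence with curling number k, and a is any single letter, then the sequence aS obtained by prefixing S with the one-term sequence a has curling number equal to k or to k + 1. -/

import Mathlib

/-- `listPow Y k` is the sequence `Y` repeated `k` times (i.e. `Y^k`). -/
def listPow {α : Type*} (Y : List α) : ℕ → List α
  | 0 => []
  | k + 1 => Y ++ listPow Y k

/-- The curling number of a finite sequence `S`: the largest `k` such that
`S = X ++ Y^k` for some (possibly empty) `X` and nonempty `Y`. -/
noncomputable def CN {α : Type*} (S : List α) : ℕ :=
  sSup {k | ∃ X Y : List α, Y ≠ [] ∧ S = X ++ listPow Y k}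

/-- A nonempty sequence is primitive if it is not a power `T^i` with `i ≥ 2`. -/
def Primitive {α : Type*} (S : List α) : Prop :=
  S ≠ [] ∧ ∀ (T : List α) (i : ℕ), 2 ≤ i → S ≠ listPow T i

/-- `T` is a proper suffix of `S`: a suffix which is strictly shorter than `S`. -/
def ProperSuffix {α : Type*} (T S : List α) : Prop := T <:+ S ∧ T.length < S.length

/-- A sequence `S` with curling number `k` is robust if no proper suffix of
`S^(k+1)` has curling number `≥ k + 1`. -/
def Robust {α : Type*} (S : List α) : Prop :=
  ∀ T : List α, ProperSuffix T (listPow S (CN S + 1)) → CN T ≤ CN S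

theorem length_listPow {α : Type*} (Y : List α) (k : ℕ) :
    (listPow Y k).length = k * Y.length := by
  induction k with
  | zero => simp [listPow]
  | succ k ih => simp [listPow, ih]; ring

theorem bddAbove_listPow_suffix {α : Type*} (S : List α) :
    BddAbove {k | ∃ X Y : List α, Y ≠ [] ∧ S = X ++ listPow Y k} := by
  refine ⟨S.length, ?_⟩
  rintro k ⟨X, Y, hY, rfl⟩
  rw [List.length_append, length_listPow]
  exact (Nat.le_mul_of_pos_right k (List.length_pos_iff.mpr hY)).trans (Nat.le_add_left _ _)

theorem le_CN {α : Type*} {S X Y : List α} {k : ℕ} (hY : Y ≠ []) (h : S = X ++ listPow Y k) :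
    k ≤ CN S :=
  le_csSup (bddAbove_listPow_suffix S) ⟨X, Y, hY, h⟩

theorem exists_eq_append_listPow_CN {α : Type*} {S : List α} (hS : S ≠ []) :
    ∃ X Y : List α, Y ≠ [] ∧ S = X ++ listPow Y (CN S) :=
  Nat.sSup_mem (s := {k | ∃ X Y : List α, Y ≠ [] ∧ S = X ++ listPow Y k})
    ⟨0, S, S, hS, by simp [listPow]⟩ (bddAbove_listPow_suffix S)

theorem CN_le_CN_cons {α : Type*} {S : List α} (hS : S ≠ []) (a : α) : CN S ≤ CN (a :: S) := by
  obtain ⟨X, Y, hY, h⟩ := exists_eq_append_listPow_CN hS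
  exact le_CN (X := a :: X) hY (congrArg (a :: ·) h)

theorem CN_cons_le {α : Type*} (S : List α) (a : α) : CN (a :: S) ≤ CN S + 1 := by
  obtain ⟨X, Y, hY, h⟩ := exists_eq_append_listPow_CN (List.cons_ne_nil a S)
  generalize CN (a :: S) = m at h ⊢
  cases X with
  | cons b X => exact (le_CN hY (List.cons.inj h).2).trans (Nat.le_succ _)
  | nil =>
    cases m with
    | zero => exact Nat.zero_le _
    | succ m =>
      obtain ⟨b, Z, rfl⟩ := List.exists_cons_of_ne_nil hY
      exact Nat.succ_le_succ (le_CN hY (List.cons.inj h).2)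

/-- Prefixing a nonempty sequence with a single letter cannot change the curling number
except possibly to increase it by exactly 1. -/
theorem CN_cons {α : Type*} (S : List α) (hS : S ≠ []) (a : α) :
    CN (a :: S) = CN S ∨ CN (a :: S) = CN S + 1 := by
  have h₁ := CN_le_CN_cons hS a
  have h₂ := CN_cons_le S a
  omega
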